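/- arXiv:math/0102218 — 4 statements merged into one kernel-verified Lean document; each statement's English description precedes it below -/
import Mathlib

section
/- Let λ be a real number with −4/3 < λ < 0, and let (u_n)_{n≥0} be any complex sequence satisfying the linear recurrence 3u_{n+1} − 4(1+λ)u_n + (1+2λ)u_{n−1} = 0 for all n ≥ 1. Then u_n → 0 as n → ∞. -/
open Filter

/-- The Jury criterion: under these conditions the roots of a real monic quadratic
`z ^ 2 - p * z + q` lie in the open unit disc. -/
theorem Complex.norm_lt_one_of_quadratic_eq_zero {p q : ℝ} (hq : q < 1) (hp₁ : p < 1 + q)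
    (hp₂ : -(1 + q) < p) {z : ℂ} (hz : z ^ 2 - p * z + q = 0) : ‖z‖ < 1 := by
  have hre := congrArg Complex.re hz
  have him := congrArg Complex.im hz
  simp only [pow_two, Complex.add_re, Complex.sub_re, Complex.mul_re, Complex.ofReal_re,
    Complex.ofReal_im, Complex.zero_re, Complex.add_im, Complex.sub_im, Complex.mul_im,
    Complex.zero_im] at hre him
  suffices h : z.re ^ 2 + z.im ^ 2 < 1 by
    have hn := Complex.sq_norm z
    rw [Complex.normSq_apply] at hn
    nlinarith [norm_nonneg z]
  rcases eq_or_ne z.im 0 with hy | hy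
  · rw [hy] at hre ⊢
    have hlt : z.re < 1 := by
      by_contra! h
      nlinarith [mul_nonneg (sub_nonneg.2 h) (by linarith : 0 ≤ z.re + 1 - p)]
    have hgt : -1 < z.re := by
      by_contra! h
      nlinarith [mul_nonneg (by linarith : 0 ≤ -1 - z.re) (by linarith : 0 ≤ 1 - z.re + p)]
    nlinarith
  · have hx : p = 2 * z.re := by
      apply mul_right_cancel₀ hy
      linarith
    subst hx
    nlinarith

/-- If both characteristic roots of a second-order linear recurrence lie in the open unit disc,
all its solutions tend to zero. -/
theorem tendsto_zero_of_linear_recurrence {z w : ℂ} (hz : ‖z‖ < 1) (hw : ‖w‖ < 1) {u : ℕ → ℂ}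
    (hu : ∀ n, u (n + 2) = (z + w) * u (n + 1) - z * w * u n) : Tendsto u atTop (nhds 0) := by
  obtain ⟨r, hr, hr1⟩ := exists_between (max_lt hz hw)
  have hzr : ‖z‖ ≤ r := (le_max_left _ _).trans hr.le
  have hwr : ‖w‖ ≤ r := (le_max_right _ _).trans hr.le
  have hr0 : 0 < r := ((norm_nonneg z).trans (le_max_left _ _)).trans_lt hr
  have hv (n : ℕ) : u (n + 1) - z * u n = w ^ n * (u 1 - z * u 0) := by
    induction n with
    | zero => simp
    | succ n ih => rw [pow_succ', mul_assoc, ← ih, hu]; ring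
  set B := ‖u 1 - z * u 0‖ / r with hB
  have hBr : ‖u 1 - z * u 0‖ = r * B := by rw [hB]; field_simp
  have hbound (n : ℕ) : ‖u n‖ ≤ r ^ n * ‖u 0‖ + n * r ^ n * B := by
    induction n with
    | zero => simp
    | succ n ih =>
      calc ‖u (n + 1)‖ = ‖z * u n + w ^ n * (u 1 - z * u 0)‖ := by rw [← hv n]; congr 1; ring
        _ ≤ ‖z‖ * ‖u n‖ + ‖w‖ ^ n * ‖u 1 - z * u 0‖ := by
          refine (norm_add_le _ _).trans_eq ?_
          rw [norm_mul, norm_mul, norm_pow]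
        _ ≤ r * (r ^ n * ‖u 0‖ + n * r ^ n * B) + r ^ n * (r * B) := by rw [hBr.symm]; gcongr
        _ = _ := by push_cast; ring
  refine squeeze_zero_norm hbound ?_
  simpa using ((tendsto_pow_atTop_nhds_zero_of_lt_one hr0.le hr1).mul_const ‖u 0‖).add
    ((tendsto_self_mul_const_pow_of_lt_one hr0.le hr1).mul_const B)

theorem recurrence_solution_tendsto_zero (lam : ℝ) (h1 : -4/3 < lam) (h2 : lam < 0)
    (u : ℕ → ℂ)
    (hu : ∀ n : ℕ, 1 ≤ n →
      3 * u (n + 1) - 4 * (1 + (lam : ℂ)) * u n + (1 + 2 * (lam : ℂ)) * u (n - 1) = 0) :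
    Tendsto u atTop (nhds 0) := by
  set p : ℝ := 4 * (1 + lam) / 3 with hp
  set q : ℝ := (1 + 2 * lam) / 3 with hq
  obtain ⟨s, hs⟩ := IsAlgClosed.exists_pow_nat_eq ((p : ℂ) ^ 2 - 4 * q) two_pos
  have hroot {z : ℂ} (hz : z ^ 2 - p * z + q = 0) : ‖z‖ < 1 :=
    Complex.norm_lt_one_of_quadratic_eq_zero (by linarith) (by linarith) (by linarith) hz
  refine tendsto_zero_of_linear_recurrence (z := (p + s) / 2) (w := (p - s) / 2)
    (hroot (by linear_combination hs / 4)) (hroot (by linear_combination hs / 4)) fun n => ?_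
  have h := hu (n + 1) (by omega)
  have hpC : (p : ℂ) = 4 * (1 + lam) / 3 := by rw [hp]; push_cast; rfl
  have hqC : (q : ℂ) = (1 + 2 * lam) / 3 := by rw [hq]; push_cast; rfl
  simp only [Nat.add_sub_cancel] at h
  linear_combination h / 3 - u (n + 1) * hpC + u n * hqC - u n * hs / 4
end

section
/- The filter function σ : ℝ → ℝ defined by σ(ξ) = (35 − 84y + 70y² − 20y³)y⁴ with y = (1 + cos(πξ))/2 is infinitely differentiable, and its iterated derivatives at 0 vanish to order 7: σ^{(l)}(0) = 0 for every l with 1 ≤ l ≤ 7. -/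
open Real

noncomputable def filterSigma (ξ : ℝ) : ℝ :=
  (35 - 84 * ((1 + Real.cos (π * ξ)) / 2) + 70 * ((1 + Real.cos (π * ξ)) / 2) ^ 2
    - 20 * ((1 + Real.cos (π * ξ)) / 2) ^ 3) * ((1 + Real.cos (π * ξ)) / 2) ^ 4

theorem filterSigma_eq_one_add_sin_pow_mul (ξ : ℝ) :
    filterSigma ξ = 1 + sin (π * ξ / 2) ^ 8 * (-35 + 84 * sin (π * ξ / 2) ^ 2
      - 70 * sin (π * ξ / 2) ^ 4 + 20 * sin (π * ξ / 2) ^ 6) := by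
  have h : cos (π * ξ) = 1 - 2 * sin (π * ξ / 2) ^ 2 := by
    rw [show π * ξ = 2 * (π * ξ / 2) by ring, cos_two_mul, cos_sq',
      show 2 * (π * ξ / 2) / 2 = π * ξ / 2 by ring]
    ring
  rw [filterSigma, h]
  ring

/-- The first `n - 1` derivatives of `c + s ^ n * q` vanish at a zero of `s`. -/
theorem iteratedDeriv_const_add_pow_mul_eq_zero {s q : ℝ → ℝ} {x : ℝ} (c : ℝ)
    (hs : AnalyticAt ℝ s x) (hq : AnalyticAt ℝ q x) (hx : s x = 0) {n l : ℕ}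
    (hl : 1 ≤ l) (hln : l < n) :
    iteratedDeriv l (fun t => c + s t ^ n * q t) x = 0 := by
  have h_order : (n : ℕ∞) ≤ analyticOrderAt (s ^ n * q) x := by
    rw [analyticOrderAt_mul (hs.pow n) hq, analyticOrderAt_pow hs, nsmul_eq_mul]
    have h_one : 1 ≤ analyticOrderAt s x :=
      Order.one_le_iff_pos.mpr (pos_iff_ne_zero.mpr (hs.analyticOrderAt_ne_zero.mpr hx))
    calc (n : ℕ∞) = n * 1 := (mul_one _).symm
      _ ≤ n * analyticOrderAt s x := by gcongr
      _ ≤ _ := le_self_add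
  have h_zero := (natCast_le_analyticOrderAt_iff_iteratedDeriv_eq_zero
    ((hs.pow n).mul hq)).mp h_order l hln
  rw [iteratedDeriv_const_add (by omega)]
  exact h_zero

theorem filterSigma_smooth_flat_at_zero :
    ContDiff ℝ (⊤ : ℕ∞) filterSigma ∧
    ∀ l : ℕ, 1 ≤ l → l ≤ 7 → iteratedDeriv l filterSigma 0 = 0 := by
  refine ⟨by unfold filterSigma; fun_prop, fun l hl hl7 => ?_⟩
  rw [funext filterSigma_eq_one_add_sin_pow_mul]
  exact iteratedDeriv_const_add_pow_mul_eq_zero 1 (s := fun t => sin (π * t / 2))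
    (by fun_prop) (by fun_prop) (by simp) hl (by omega)
end

section
/- The filter function σ : ℝ → ℝ defined by σ(ξ) = (35 − 84y + 70y² − 20y³)y⁴ with y = (1 + cos(πξ))/2 vanishes together with its first seven derivatives at ξ = 1: σ^{(l)}(1) = 0 for every l with 0 ≤ l ≤ 7. -/
open Real

/-- `1 + cos (π ξ)` vanishes to second order at `ξ = 1`. -/
lemma two_le_analyticOrderAt_one_add_cos_pi_mul :
    2 ≤ analyticOrderAt (fun ξ : ℝ => (1 + Real.cos (π * ξ)) / 2) 1 := by
  refine (natCast_le_analyticOrderAt_iff_iteratedDeriv_eq_zero (n := 2) (by fun_prop)).2 ?_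
  intro i hi
  interval_cases i
  · simp
  · have h : HasDerivAt (fun ξ : ℝ => (1 + Real.cos (π * ξ)) / 2)
        (-Real.sin (π * 1) * (π * 1) / 2) 1 :=
      ((((hasDerivAt_id (1 : ℝ)).const_mul π).cos).const_add 1).div_const 2
    rw [iteratedDeriv_one, h.deriv]
    simp

theorem filterSigma_flat_at_one :
    ∀ l : ℕ, l ≤ 7 → iteratedDeriv l filterSigma 1 = 0 := by
  intro l hl
  have hy : AnalyticAt ℝ (fun ξ : ℝ => (1 + Real.cos (π * ξ)) / 2) 1 := by fun_prop
  have hp : AnalyticAt ℝ (fun ξ : ℝ => 35 - 84 * ((1 + Real.cos (π * ξ)) / 2)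
      + 70 * ((1 + Real.cos (π * ξ)) / 2) ^ 2 - 20 * ((1 + Real.cos (π * ξ)) / 2) ^ 3) 1 := by
    fun_prop
  have hσ : filterSigma = (fun ξ : ℝ => 35 - 84 * ((1 + Real.cos (π * ξ)) / 2)
      + 70 * ((1 + Real.cos (π * ξ)) / 2) ^ 2 - 20 * ((1 + Real.cos (π * ξ)) / 2) ^ 3)
      * (fun ξ : ℝ => (1 + Real.cos (π * ξ)) / 2) ^ 4 := rfl
  have hord : ((8 : ℕ) : ℕ∞) ≤ analyticOrderAt filterSigma 1 := by
    rw [hσ, analyticOrderAt_mul hp (hy.pow 4), analyticOrderAt_pow hy]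
    calc ((8 : ℕ) : ℕ∞) = 4 • 2 := by norm_num
      _ ≤ 4 • analyticOrderAt (fun ξ : ℝ => (1 + Real.cos (π * ξ)) / 2) 1 :=
        nsmul_le_nsmul_right two_le_analyticOrderAt_one_add_cos_pi_mul 4
      _ ≤ _ := le_add_self
  have han : AnalyticAt ℝ filterSigma 1 := hσ ▸ hp.mul (hy.pow 4)
  exact (natCast_le_analyticOrderAt_iff_iteratedDeriv_eq_zero han).1 hord l (by lia)
end

section
/- Let σ : ℝ → ℝ be defined by σ(ξ) = (35 − 84y + 70y² − 20y³)y⁴ with y = (1 + cos(πξ))/2, and let τ : ℝ → ℝ be defined by τ(ξ) = σ(ξ) for |ξ| ≤ 1 and τ(ξ) = 0 for |ξ| > 1. Then τ is 7 times continuously differentiable on ℝ. -/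
open Real

noncomputable def filterTau (ξ : ℝ) : ℝ :=
  if |ξ| ≤ 1 then filterSigma ξ else 0

theorem HasDerivAt.indicator_of_frontier {s : Set ℝ} {f f' : ℝ → ℝ}
    (hf : ∀ x, HasDerivAt f (f' x) x) (h : ∀ x ∈ frontier s, f x = 0)
    (h' : ∀ x ∈ frontier s, f' x = 0) (x : ℝ) :
    HasDerivAt (s.indicator f) (s.indicator f' x) x := by
  by_cases hx : x ∈ frontier s
  · have hfx : HasDerivAt f 0 x := h' x hx ▸ hf x
    have e : ∀ g : ℝ → ℝ, g x = 0 → s.indicator g x = 0 := fun g hg => by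
      by_cases hs : x ∈ s <;> simp [hs, hg]
    rw [e f' (h' x hx)]
    rw [hasDerivAt_iff_isLittleO] at hfx ⊢
    refine (Asymptotics.IsBigO.of_bound 1 (Filter.Eventually.of_forall fun y => ?_)).trans_isLittleO
      hfx
    simpa [e f (h x hx), h x hx] using norm_indicator_le_norm_self f y
  · by_cases hs : x ∈ s
    · have hi : x ∈ interior s := by
        by_contra hi
        exact hx ⟨subset_closure hs, hi⟩
      rw [Set.indicator_of_mem hs]
      refine (hf x).congr_of_eventuallyEq ?_
      filter_upwards [mem_interior_iff_mem_nhds.1 hi] with y hy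
      exact Set.indicator_of_mem hy f
    · have hc : x ∉ closure s := fun hc => hx ⟨hc, fun hi => hs (interior_subset hi)⟩
      rw [Set.indicator_of_notMem hs]
      refine (hasDerivAt_const x (0 : ℝ)).congr_of_eventuallyEq ?_
      filter_upwards [isClosed_closure.isOpen_compl.mem_nhds hc] with y hy
      exact Set.indicator_of_notMem (fun hys => hy (subset_closure hys)) f

open scoped ContDiff in
/-- Cutting off a smooth function with a zero of order `n + 1` on the boundary of the
cutoff set yields a function of class `C^n`. -/
theorem ContDiff.indicator_mul_pow_succ {s : Set ℝ} {c : ℝ → ℝ} (hc : ContDiff ℝ ∞ c)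
    (hs : ∀ x ∈ frontier s, c x = 0) (n : ℕ) {p : ℝ → ℝ} (hp : ContDiff ℝ ∞ p) :
    ContDiff ℝ n (s.indicator fun x => p x * c x ^ (n + 1)) := by
  induction n generalizing p with
  | zero =>
    rw [Nat.cast_zero, contDiff_zero]
    refine Continuous.indicator (fun x hx => by simp [hs x hx]) ?_
    exact hp.continuous.mul (hc.continuous.pow _)
  | succ n ih =>
    have hd := HasDerivAt.indicator_of_frontier (s := s)
      (f := fun x => p x * c x ^ (n + 1 + 1))
      (f' := fun x => (deriv p x * c x + (n + 2) * p x * deriv c x) * c x ^ (n + 1))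
      (fun x => by
        have h := (hp.differentiable (by simp) x).hasDerivAt.mul
          ((hc.differentiable (by simp) x).hasDerivAt.pow (n + 1 + 1))
        refine h.congr_deriv ?_
        simp only [Nat.add_sub_cancel, Pi.pow_apply]
        push_cast
        ring)
      (fun x hx => by simp [hs x hx]) (fun x hx => by simp [hs x hx])
    rw [Nat.cast_succ, contDiff_succ_iff_deriv]
    refine ⟨fun x => (hd x).differentiableAt, by simp, ?_⟩
    rw [funext fun x => (hd x).deriv]
    have hp' : ContDiff ℝ ∞ (deriv p) := (contDiff_infty_iff_deriv.1 hp).2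
    have hc' : ContDiff ℝ ∞ (deriv c) := (contDiff_infty_iff_deriv.1 hc).2
    exact ih ((hp'.mul hc).add ((contDiff_const.mul hp).mul hc'))

theorem filterSigma_eq_mul_cos_pow (ξ : ℝ) :
    filterSigma ξ = (35 - 84 * cos (π / 2 * ξ) ^ 2 + 70 * cos (π / 2 * ξ) ^ 4
      - 20 * cos (π / 2 * ξ) ^ 6) * cos (π / 2 * ξ) ^ (7 + 1) := by
  have h : (1 + cos (π * ξ)) / 2 = cos (π / 2 * ξ) ^ 2 := by
    rw [cos_sq]
    ring_nf
  rw [filterSigma, h]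
  ring

theorem filterTau_contDiff_seven : ContDiff ℝ 7 filterTau := by
  have h : filterTau = (Set.Icc (-1 : ℝ) 1).indicator fun ξ =>
      (35 - 84 * cos (π / 2 * ξ) ^ 2 + 70 * cos (π / 2 * ξ) ^ 4
        - 20 * cos (π / 2 * ξ) ^ 6) * cos (π / 2 * ξ) ^ (7 + 1) := by
    ext ξ
    simp only [filterTau, Set.indicator_apply, Set.mem_Icc, abs_le, filterSigma_eq_mul_cos_pow]
  rw [h]
  refine ContDiff.indicator_mul_pow_succ (c := fun ξ => cos (π / 2 * ξ)) (by fun_prop) ?_ 7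
    (by fun_prop)
  rw [frontier_Icc (by norm_num)]
  rintro x (rfl | rfl) <;> simp
end
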